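/- Let (X,d,T) be a topological dynamical system and μ an ergodic T-invariant Borel probability measure. Then μ×μ({(x,y) ∈ X×X : F(x,y) = 0}) = 1, where F is the weak-mean pseudometric. (Hint: by the Birkhoff ergodic theorem generic points have the same unique distribution measure, and points with equal single distribution measure are at weak-mean distance 0.) -/

import Mathlib

open Filter Metric Set

variable {X : Type*} [MetricSpace X]

/-- The maximal cardinality of an `(n,δ)`-match of `x` and `y`: an order-preserving
bijection `π : D(π) → R(π)` between subsets of `{0,…,n-1}` such that
`d(T^i x, T^{π i} y) < δ` for all `i ∈ D(π)`, encoded by a pair of strictly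
increasing enumerations of `D(π)` and `R(π)`. -/
noncomputable def fkFit (T : X → X) (n : ℕ) (δ : ℝ) (x y : X) : ℕ :=
  sSup {k : ℕ | ∃ i j : Fin k → Fin n, StrictMono i ∧ StrictMono j ∧
    ∀ s, dist (T^[(i s : ℕ)] x) (T^[(j s : ℕ)] y) < δ}

/-- `f̄_{n,δ}(x,y) = 1 - (max match)/n`. -/
noncomputable def fkF (T : X → X) (n : ℕ) (δ : ℝ) (x y : X) : ℝ :=
  1 - (fkFit T n δ x y : ℝ) / n

/-- The Feldman–Katok metric `d_{FK_n}`. -/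
noncomputable def dFKn (T : X → X) (n : ℕ) (x y : X) : ℝ :=
  sInf {δ : ℝ | 0 < δ ∧ fkF T n δ x y < δ}

/-- The Feldman–Katok pseudometric `d_{FK}`. -/
noncomputable def dFK (T : X → X) (x y : X) : ℝ :=
  sInf {δ : ℝ | 0 < δ ∧ Filter.limsup (fun n => fkF T n δ x y) atTop < δ}

/-- The maximal cardinality of an `(n,δ)*`-match of `x` and `y`: a not necessarily
order-preserving bijection `π : D(π) → R(π)` between subsets of `{0,…,n-1}` with
`d(T^i x, T^{π i} y) < δ` on its domain, encoded by a pair of injections. -/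
noncomputable def wFit (T : X → X) (n : ℕ) (δ : ℝ) (x y : X) : ℕ :=
  sSup {k : ℕ | ∃ i j : Fin k → Fin n, Function.Injective i ∧ Function.Injective j ∧
    ∀ s, dist (T^[(i s : ℕ)] x) (T^[(j s : ℕ)] y) < δ}

/-- `f̃_{n,δ}(x,y) = 1 - (max match)/n`. -/
noncomputable def wFbar (T : X → X) (n : ℕ) (δ : ℝ) (x y : X) : ℝ :=
  1 - (wFit T n δ x y : ℝ) / n

/-- The Feldman–Katok pseudometric without the order-preserving requirement. -/
noncomputable def dFKt (T : X → X) (x y : X) : ℝ :=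
  sInf {δ : ℝ | 0 < δ ∧ Filter.limsup (fun n => wFbar T n δ x y) atTop < δ}

/-- `F_n(x,y) = (1/n) inf_{σ ∈ S_n} ∑_{k<n} d(T^k x, T^{σ k} y)`. -/
noncomputable def weakMeanN (T : X → X) (n : ℕ) (x y : X) : ℝ :=
  (1 / n : ℝ) * ⨅ σ : Equiv.Perm (Fin n),
    ∑ k : Fin n, dist (T^[(k : ℕ)] x) (T^[(σ k : ℕ)] y)

/-- The weak-mean pseudometric `F(x,y) = limsup_n F_n(x,y)`. -/
noncomputable def weakMean (T : X → X) (x y : X) : ℝ :=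
  Filter.limsup (fun n => weakMeanN T n x y) Filter.atTop

section Aux
open MeasureTheory Topology

/-- running maxima of Birkhoff sums -/
noncomputable def maxSum {Y : Type*} (T : Y → Y) (g : Y → ℝ) : ℕ → Y → ℝ
  | 0 => fun _ => 0
  | n + 1 => fun x => max 0 (g x + maxSum T g n (T x))

section BK
variable {Y : Type*} (T : Y → Y) (g : Y → ℝ)

lemma maxSum_succ (n : ℕ) (x : Y) :
    maxSum T g (n + 1) x = max 0 (g x + maxSum T g n (T x)) := rfl

lemma maxSum_nonneg (n : ℕ) (x : Y) : 0 ≤ maxSum T g n x := by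
  cases n with
  | zero => exact le_refl _
  | succ n => exact le_max_left _ _

lemma maxSum_le_succ (n : ℕ) : ∀ x : Y, maxSum T g n x ≤ maxSum T g (n + 1) x := by
  induction n with
  | zero => intro x; exact maxSum_nonneg T g 1 x
  | succ n ih =>
    intro x
    rw [maxSum_succ, maxSum_succ T g (n + 1)]
    have := ih (T x)
    gcongr

lemma maxSum_mono (x : Y) : Monotone (fun n => maxSum T g n x) :=
  monotone_nat_of_le_succ (fun n => maxSum_le_succ T g n x)

lemma birkhoffSum_le_maxSum (n : ℕ) : ∀ x : Y, birkhoffSum T g n x ≤ maxSum T g n x := by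
  induction n with
  | zero => intro x; simp [maxSum]
  | succ n ih =>
    intro x
    rw [birkhoffSum_succ', maxSum_succ]
    exact le_max_of_le_right (by have := ih (T x); gcongr)

lemma maxSum_le {C : ℝ} (hC : ∀ x, |g x| ≤ C) (n : ℕ) :
    ∀ x : Y, maxSum T g n x ≤ n * C := by
  induction n with
  | zero => intro x; simp [maxSum]
  | succ n ih =>
    intro x
    rw [maxSum_succ]
    have h1 := ih (T x)
    have h2 := hC x
    have h3 := abs_nonneg (g x)
    have h4 := le_abs_self (g x)
    push_cast
    have h5 : (0 : ℝ) ≤ n * C := mul_nonneg (Nat.cast_nonneg _) (h3.trans h2)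
    exact max_le (by linarith) (by linarith)

variable [MeasurableSpace Y]

lemma maxSum_measurable (hT : Measurable T) (hg : Measurable g) (n : ℕ) :
    Measurable (maxSum T g n) := by
  induction n with
  | zero => exact measurable_const
  | succ n ih => exact measurable_const.max (hg.add (ih.comp hT))

lemma birkhoff_bdd {μ : Measure Y} [IsProbabilityMeasure μ] (hμ : Ergodic T μ)
    (hg : Measurable g) {C : ℝ} (hC : ∀ x, |g x| ≤ C) (hneg : ∫ x, g x ∂μ < 0) :
    ∀ᵐ x ∂μ, ∃ B : ℝ, ∀ n, birkhoffSum T g n x ≤ B := by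
  have hT : Measurable T := hμ.measurable
  have hGm := maxSum_measurable T g hT hg
  set A : Set Y := {x | ∀ N : ℕ, ∃ n, (N : ℝ) < maxSum T g n x} with hA
  have hAm : MeasurableSet A := by
    have : A = ⋂ N : ℕ, ⋃ n, {x | (N : ℝ) < maxSum T g n x} := by
      ext x; simp [hA]
    rw [this]
    exact MeasurableSet.iInter fun N => MeasurableSet.iUnion fun n =>
      measurableSet_lt measurable_const (hGm n)
  have hinv : T ⁻¹' A = A := by
    ext x
    simp only [hA, mem_preimage, mem_ofPred_eq]
    constructor
    · intro h N
      obtain ⟨M, hM⟩ := exists_nat_gt ((N : ℝ) - g x)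
      obtain ⟨n, hn⟩ := h M
      refine ⟨n + 1, ?_⟩
      rw [maxSum_succ]
      exact lt_max_of_lt_right (by linarith)
    · intro h N
      obtain ⟨M, hM⟩ := exists_nat_gt ((N : ℝ) + |g x|)
      obtain ⟨n, hn⟩ := h M
      refine ⟨n, ?_⟩
      have h1 := maxSum_le_succ T g n x
      rw [maxSum_succ] at h1
      have h2 := maxSum_nonneg T g n (T x)
      have h3 := le_abs_self (g x)
      have h4 := abs_nonneg (g x)
      have h5 : max 0 (g x + maxSum T g n (T x)) ≤ |g x| + maxSum T g n (T x) :=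
        max_le (by linarith) (by linarith)
      linarith
  rcases hμ.toPreErgodic.ae_empty_or_univ hAm hinv with h | h
  · have h' : ∀ᵐ x ∂μ, x ∉ A := by
      filter_upwards [h] with x hx hxA
      have : (x ∈ A) = (x ∈ (∅ : Set Y)) := hx
      simp [hxA] at this
    filter_upwards [h'] with x hx
    simp only [hA, mem_ofPred_eq, not_forall, not_exists, not_lt] at hx
    obtain ⟨N, hN⟩ := hx
    exact ⟨N, fun n => (birkhoffSum_le_maxSum T g n x).trans (hN n)⟩
  · exfalso
    have h' : ∀ᵐ x ∂μ, x ∈ A := by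
      filter_upwards [h] with x hx
      have : (x ∈ A) = (x ∈ (univ : Set Y)) := hx
      simp [this]
    have hint : ∀ n, Integrable (maxSum T g n) μ := fun n =>
      Integrable.of_bound (hGm n).aestronglyMeasurable (n * C) (Eventually.of_forall fun x => by
        rw [Real.norm_eq_abs, abs_of_nonneg (maxSum_nonneg T g n x)]
        exact maxSum_le T g hC n x)
    have hintT : ∀ n, Integrable (fun x => maxSum T g n (T x)) μ := fun n =>
      hμ.toMeasurePreserving.integrable_comp_of_integrable (hint n)
    have heq : ∀ n, ∫ x, maxSum T g n (T x) ∂μ = ∫ x, maxSum T g n x ∂μ := fun n => by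
      have h1 := integral_map (μ := μ) hT.aemeasurable
        (f := maxSum T g n) (hGm n).aestronglyMeasurable
      rw [hμ.toMeasurePreserving.map_eq] at h1
      exact h1.symm
    have hnn : ∀ n, 0 ≤ ∫ x, (maxSum T g (n + 1) x - maxSum T g n (T x)) ∂μ := fun n => by
      rw [integral_sub (hint _) (hintT n), heq n, sub_nonneg]
      exact integral_mono (hint _) (hint _) (maxSum_le_succ T g n)
    have hlim : Tendsto (fun n => ∫ x, (maxSum T g (n + 1) x - maxSum T g n (T x)) ∂μ) atTop
        (𝓝 (∫ x, g x ∂μ)) := by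
      refine tendsto_integral_of_dominated_convergence (fun _ => C) ?_ (integrable_const C) ?_ ?_
      · intro n
        exact ((hGm (n + 1)).sub ((hGm n).comp hT)).aestronglyMeasurable
      · intro n
        refine Eventually.of_forall fun x => ?_
        refine le_trans ?_ (hC x)
        rw [Real.norm_eq_abs, maxSum_succ]
        have h2 := maxSum_nonneg T g n (T x)
        have h3 := le_abs_self (g x)
        have h4 := neg_abs_le (g x)
        rw [abs_le]
        rcases max_cases 0 (g x + maxSum T g n (T x)) with h | h
        · constructor <;> linarith [abs_nonneg (g x)]
        · constructor <;> linarith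
      · filter_upwards [h'] with x hx
        have hTx : T x ∈ A := by
          have : x ∈ T ⁻¹' A := by rw [hinv]; exact hx
          exact this
        obtain ⟨M, hM⟩ := exists_nat_gt (- g x)
        obtain ⟨n₀, hn₀⟩ := hTx M
        refine tendsto_const_nhds.congr' ?_
        filter_upwards [eventually_ge_atTop n₀] with n hn
        have := maxSum_mono T g (T x) hn
        simp only at this
        rw [maxSum_succ, max_eq_right (by linarith)]
        ring
    have := ge_of_tendsto' hlim hnn
    linarith

/-- upper frequency bound -/
lemma freq_upper {μ : Measure Y} [IsProbabilityMeasure μ] (hμ : Ergodic T μ)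
    {A : Set Y} (hA : MeasurableSet A) {ε : ℝ} (hε : 0 < ε) :
    ∀ᵐ x ∂μ, ∀ᶠ n : ℕ in atTop,
      birkhoffSum T (A.indicator (fun _ => (1 : ℝ))) n x / n ≤ μ.real A + ε := by
  set g : Y → ℝ := fun x => A.indicator (fun _ => (1 : ℝ)) x - (μ.real A + ε / 2) with hgdef
  have hm : Measurable (A.indicator (fun _ => (1 : ℝ))) := measurable_const.indicator hA
  have hg : Measurable g := hm.sub measurable_const
  have hC : ∀ x, |g x| ≤ 1 + |μ.real A + ε / 2| := by
    intro x
    refine (abs_sub _ _).trans ?_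
    gcongr
    by_cases hx : x ∈ A <;> simp [hx]
  have hI : ∫ x, g x ∂μ < 0 := by
    rw [hgdef, integral_sub ((integrable_const (1 : ℝ)).indicator hA) (integrable_const _),
      integral_indicator hA]
    simp
    linarith
  filter_upwards [birkhoff_bdd T g hμ hg hC hI] with x hx
  obtain ⟨B, hB⟩ := hx
  have hlim : Tendsto (fun n : ℕ => B / (n : ℝ)) atTop (𝓝 0) :=
    tendsto_const_div_atTop_nhds_zero_nat B
  filter_upwards [hlim.eventually (gt_mem_nhds (half_pos hε)), eventually_gt_atTop 0] with n h1 h2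
  have h3 := hB n
  have h4 : birkhoffSum T g n x = birkhoffSum T (A.indicator (fun _ => (1 : ℝ))) n x
      - n * (μ.real A + ε / 2) := by
    simp [birkhoffSum, hgdef, Finset.sum_sub_distrib]
    ring
  have hn : (0 : ℝ) < n := Nat.cast_pos.mpr h2
  rw [div_lt_iff₀ hn] at h1
  rw [div_le_iff₀ hn]
  nlinarith

lemma freq_tendsto {μ : Measure Y} [IsProbabilityMeasure μ] (hμ : Ergodic T μ)
    {A : Set Y} (hA : MeasurableSet A) :
    ∀ᵐ x ∂μ, Tendsto (fun n : ℕ =>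
      birkhoffSum T (A.indicator (fun _ => (1 : ℝ))) n x / n) atTop (𝓝 (μ.real A)) := by
  have h1 : ∀ᵐ x ∂μ, ∀ j : ℕ, ∀ᶠ n : ℕ in atTop,
      birkhoffSum T (A.indicator (fun _ => (1 : ℝ))) n x / n ≤ μ.real A + 1 / ((j : ℝ) + 1) :=
    ae_all_iff.2 fun j => freq_upper T hμ hA Nat.one_div_pos_of_nat
  have h2 : ∀ᵐ x ∂μ, ∀ j : ℕ, ∀ᶠ n : ℕ in atTop,
      birkhoffSum T (Aᶜ.indicator (fun _ => (1 : ℝ))) n x / n ≤ μ.real Aᶜ + 1 / ((j : ℝ) + 1) :=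
    ae_all_iff.2 fun j => freq_upper T hμ hA.compl Nat.one_div_pos_of_nat
  filter_upwards [h1, h2] with x hx1 hx2
  rw [Metric.tendsto_nhds]
  intro ε hε
  obtain ⟨j, hj⟩ := exists_nat_one_div_lt hε
  filter_upwards [hx1 j, hx2 j, eventually_gt_atTop 0] with n a1 a2 h0
  have hn : (0 : ℝ) < n := Nat.cast_pos.mpr h0
  have hs : birkhoffSum T (A.indicator (fun _ => (1 : ℝ))) n x
      + birkhoffSum T (Aᶜ.indicator (fun _ => (1 : ℝ))) n x = n := by
    rw [birkhoffSum, birkhoffSum, ← Finset.sum_add_distrib]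
    have : ∀ y, A.indicator (fun _ => (1 : ℝ)) y + Aᶜ.indicator (fun _ => (1 : ℝ)) y = 1 :=
      fun y => by by_cases hy : y ∈ A <;> simp [hy]
    simp [this]
  have hs' : birkhoffSum T (A.indicator (fun _ => (1 : ℝ))) n x / n
      + birkhoffSum T (Aᶜ.indicator (fun _ => (1 : ℝ))) n x / n = 1 := by
    rw [← add_div, hs, div_self hn.ne']
  rw [probReal_compl_eq_one_sub hA] at a2
  rw [Real.dist_eq, abs_lt]
  constructor <;> linarith
end BK

open Classical in
/-- Matching lemma. -/
lemma exists_perm_match {n : ℕ} {ι : Type*} [Fintype ι] (a b : Fin n → ι) :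
    ∃ σ : Equiv.Perm (Fin n),
      ((Finset.univ.filter fun k => a k ≠ b (σ k)).card : ℝ) ≤
        ∑ i, |((Finset.univ.filter fun k => a k = i).card : ℝ)
          - ((Finset.univ.filter fun k => b k = i).card : ℝ)| := by
  obtain ⟨σ, hσ⟩ := Finite.exists_min
    (fun σ : Equiv.Perm (Fin n) => (Finset.univ.filter fun k => a k ≠ b (σ k)).card)
  refine ⟨σ, ?_⟩
  have key : ∀ k l, a k ≠ b (σ k) → a l ≠ b (σ l) → b (σ l) ≠ a k := by
    intro k l hk hl hkl
    have hlt : (Finset.univ.filter fun m => a m ≠ b ((Equiv.swap k l).trans σ m)).card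
        < (Finset.univ.filter fun m => a m ≠ b (σ m)).card := by
      refine Finset.card_lt_card ?_
      rw [Finset.ssubset_iff_of_subset]
      · refine ⟨k, Finset.mem_filter.2 ⟨Finset.mem_univ _, hk⟩, fun hm => ?_⟩
        have := (Finset.mem_filter.1 hm).2
        rw [Equiv.trans_apply, Equiv.swap_apply_left] at this
        exact this hkl.symm
      · intro m hm
        refine Finset.mem_filter.2 ⟨Finset.mem_univ _, ?_⟩
        replace hm := (Finset.mem_filter.1 hm).2
        by_cases h1 : m = k
        · subst h1; exact hk
        by_cases h2 : m = l
        · subst h2; exact hl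
        rwa [Equiv.trans_apply, Equiv.swap_apply_of_ne_of_ne h1 h2] at hm
    exact absurd (hσ ((Equiv.swap k l).trans σ)) (not_le.2 hlt)
  have hsum : ((Finset.univ.filter fun k => a k ≠ b (σ k)).card : ℝ) =
      ∑ i, (((Finset.univ.filter fun k => a k ≠ b (σ k)).filter fun k => a k = i).card : ℝ) := by
    rw [← Nat.cast_sum]
    congr 1
    exact Finset.card_eq_sum_card_fiberwise (fun _ _ => Finset.mem_coe.2 (Finset.mem_univ _))
  rw [hsum]
  refine Finset.sum_le_sum fun i _ => ?_
  by_cases he : ∃ k, a k ≠ b (σ k) ∧ a k = i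
  · obtain ⟨k, hk, hki⟩ := he
    have hb : (Finset.univ.filter fun k => b k = i).card
        = (Finset.univ.filter fun k => a k = i ∧ b (σ k) = i).card := by
      symm
      refine Finset.card_bij (fun m _ => σ m) ?_ ?_ ?_
      · intro m hm
        simp only [Finset.mem_filter, Finset.mem_univ, true_and] at hm ⊢
        exact hm.2
      · intro m _ m' _ h
        exact σ.injective h
      · intro m hm
        simp only [Finset.mem_filter, Finset.mem_univ, true_and] at hm
        refine ⟨σ.symm m, ?_, by simp⟩
        simp only [Finset.mem_filter, Finset.mem_univ, true_and, Equiv.apply_symm_apply]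
        refine ⟨?_, hm⟩
        by_contra hne
        refine key k (σ.symm m) hk ?_ ?_
        · simpa [hm] using hne
        · simp [hm, hki]
    have ha : (Finset.univ.filter fun k => a k = i).card
        = (Finset.univ.filter fun k => a k = i ∧ b (σ k) = i).card
          + ((Finset.univ.filter fun k => a k ≠ b (σ k)).filter fun k => a k = i).card := by
      rw [← Finset.card_union_of_disjoint]
      · congr 1
        ext m
        simp only [Finset.mem_filter, Finset.mem_univ, true_and, Finset.mem_union]
        grind
      · rw [Finset.disjoint_left]
        intro m
        simp only [Finset.mem_filter, Finset.mem_univ, true_and]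
        grind
    refine le_trans ?_ (le_abs_self _)
    rw [hb, ha]
    push_cast
    linarith
  · have : ((Finset.univ.filter fun k => a k ≠ b (σ k)).filter fun k => a k = i) = ∅ := by
      ext m
      simp only [Finset.mem_filter, Finset.mem_univ, true_and, Finset.notMem_empty, iff_false]
      exact fun h => he ⟨m, h⟩
    rw [this]
    simp

lemma weakMeanN_nonneg (T : X → X) (n : ℕ) (x y : X) : 0 ≤ weakMeanN T n x y := by
  unfold weakMeanN
  exact mul_nonneg (by positivity)
    (Real.iInf_nonneg fun σ => Finset.sum_nonneg fun k _ => dist_nonneg)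

open Classical in
lemma card_eq_birkhoff (T : X → X) {ι : Type*} (φ : X → ι) (i : ι) (n : ℕ) (x : X) :
    ((Finset.univ.filter fun k : Fin n => φ (T^[(k : ℕ)] x) = i).card : ℝ)
      = birkhoffSum T ((φ ⁻¹' {i}).indicator (fun _ => (1 : ℝ))) n x := by
  rw [birkhoffSum, ← Fin.sum_univ_eq_sum_range
    (fun k => (φ ⁻¹' {i}).indicator (fun _ => (1 : ℝ)) (T^[k] x)), Finset.card_filter]
  push_cast
  refine Finset.sum_congr rfl fun k _ => ?_
  simp [indicator_apply]

lemma weakMeanN_le (T : X → X) {ι : Type*} [Fintype ι] (φ : X → ι) {ε D : ℝ} (hε : 0 ≤ ε)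
    (hφ : ∀ x y, φ x = φ y → dist x y ≤ ε) (hD : ∀ x y : X, dist x y ≤ D)
    (n : ℕ) (hn : 0 < n) (x y : X) :
    weakMeanN T n x y ≤ ε + D * ∑ i,
      |birkhoffSum T ((φ ⁻¹' {i}).indicator (fun _ => (1 : ℝ))) n x / n
        - birkhoffSum T ((φ ⁻¹' {i}).indicator (fun _ => (1 : ℝ))) n y / n| := by
  classical
  obtain ⟨σ, hσ⟩ := exists_perm_match (fun k : Fin n => φ (T^[(k : ℕ)] x))
    (fun k : Fin n => φ (T^[(k : ℕ)] y))
  have hn' : (0 : ℝ) < n := Nat.cast_pos.mpr hn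
  have hD0 : 0 ≤ D := dist_nonneg.trans (hD x x)
  simp only [card_eq_birkhoff] at hσ
  have h1 : (⨅ σ : Equiv.Perm (Fin n), ∑ k : Fin n, dist (T^[(k : ℕ)] x) (T^[(σ k : ℕ)] y))
      ≤ ∑ k : Fin n, dist (T^[(k : ℕ)] x) (T^[(σ k : ℕ)] y) :=
    ciInf_le (Set.finite_range _).bddBelow σ
  have h2 : ∑ k : Fin n, dist (T^[(k : ℕ)] x) (T^[(σ k : ℕ)] y)
      ≤ ∑ k : Fin n, (ε + D * (if φ (T^[(k : ℕ)] x) ≠ φ (T^[(σ k : ℕ)] y) then 1 else 0)) := by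
    refine Finset.sum_le_sum fun k _ => ?_
    by_cases h : φ (T^[(k : ℕ)] x) = φ (T^[(σ k : ℕ)] y)
    · simpa [h] using hφ _ _ h
    · simp only [ne_eq, h, not_false_eq_true, if_true, mul_one]
      linarith [hD (T^[(k : ℕ)] x) (T^[(σ k : ℕ)] y)]
  rw [Finset.sum_add_distrib, ← Finset.mul_sum, Finset.sum_boole] at h2
  simp only [Finset.sum_const, Finset.card_univ, Fintype.card_fin, nsmul_eq_mul] at h2
  have h3 := h1.trans (h2.trans (add_le_add_right (mul_le_mul_of_nonneg_left hσ hD0) _))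
  unfold weakMeanN
  have h4 := mul_le_mul_of_nonneg_left h3 (by positivity : (0 : ℝ) ≤ 1 / n)
  refine h4.trans (le_of_eq ?_)
  simp only [← sub_div, abs_div, abs_of_pos hn', ← Finset.sum_div]
  field_simp

lemma exists_label.{u} {X : Type u} [MetricSpace X] [CompactSpace X] [MeasurableSpace X] [BorelSpace X] {ε : ℝ} (hε : 0 < ε) :
    ∃ (ι : Type u) (_ : Fintype ι) (φ : X → ι), (∀ i, MeasurableSet (φ ⁻¹' {i})) ∧
      ∀ x y, φ x = φ y → dist x y ≤ ε := by
  classical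
  obtain ⟨t, -, ht, hcov⟩ := (isCompact_univ (X := X)).finite_cover_balls (half_pos hε)
  have : Finite t := ht
  refine ⟨Set t, Fintype.ofFinite _, fun x => {c | x ∈ ball (c : X) (ε / 2)}, ?_, ?_⟩
  · intro p
    have : (fun x : X => {c : t | x ∈ ball (c : X) (ε / 2)}) ⁻¹' {p}
        = ⋂ c : t, {x | x ∈ ball (c : X) (ε / 2) ↔ c ∈ p} := by
      ext x
      simp [Set.ext_iff]
    rw [this]
    refine MeasurableSet.iInter fun c => ?_
    by_cases hc : c ∈ p
    · have he : {x | x ∈ ball (c : X) (ε / 2) ↔ c ∈ p} = ball (c : X) (ε / 2) := by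
        ext x; simp [hc]
      rw [he]
      exact measurableSet_ball
    · have he : {x | x ∈ ball (c : X) (ε / 2) ↔ c ∈ p} = (ball (c : X) (ε / 2))ᶜ := by
        ext x; simp [hc]
      rw [he]
      exact measurableSet_ball.compl
  · intro x y hxy
    have hx := hcov (mem_univ x)
    simp only [mem_iUnion] at hx
    obtain ⟨c, hc, hxc⟩ := hx
    have hy : (⟨c, hc⟩ : t) ∈ {c : t | y ∈ ball (c : X) (ε / 2)} := by
      have hxy' : {c : t | x ∈ ball (c : X) (ε / 2)} = {c : t | y ∈ ball (c : X) (ε / 2)} := hxy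
      rw [← hxy']
      exact hxc
    have hyc : dist y c < ε / 2 := hy
    have hxc' : dist x c < ε / 2 := hxc
    linarith [dist_triangle_right x y c]

end Aux

open MeasureTheory

/-- If `μ` is ergodic, then `μ × μ`-almost every pair of points is at weak-mean
distance `0`. -/
theorem weakMean_zero_of_ergodic [MeasurableSpace X] [BorelSpace X] [CompactSpace X]
    (T : X → X) (hT : Continuous T) (μ : Measure X) [IsProbabilityMeasure μ]
    (hμ : Ergodic T μ) :
    μ.prod μ {p : X × X | weakMean T p.1 p.2 = 0} = 1 := by
  have hlab := fun j : ℕ => exists_label (X := X) (ε := 1 / ((j : ℝ) + 1)) Nat.one_div_pos_of_nat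
  choose ι hι φ hφm hφ using hlab
  set P : X → Prop := fun x => ∀ j i, Tendsto (fun n : ℕ =>
      birkhoffSum T ((φ j ⁻¹' {i}).indicator (fun _ => (1 : ℝ))) n x / n) atTop
      (nhds (μ.real (φ j ⁻¹' {i}))) with hP
  have hgood : ∀ᵐ x ∂μ, P x :=
    ae_all_iff.2 fun j => ae_all_iff.2 fun i => freq_tendsto T hμ (hφm j i)
  have h1 : ∀ᵐ p ∂(μ.prod μ), P p.1 := Measure.quasiMeasurePreserving_fst.ae hgood
  have h2 : ∀ᵐ p ∂(μ.prod μ), P p.2 := Measure.quasiMeasurePreserving_snd.ae hgood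
  have hmain : ∀ᵐ p ∂(μ.prod μ), weakMean T p.1 p.2 = 0 := by
    filter_upwards [h1, h2] with p hp1 hp2
    have hlim : Tendsto (fun n => weakMeanN T n p.1 p.2) atTop (nhds 0) := by
      rw [Metric.tendsto_nhds]
      intro ε hε
      obtain ⟨j, hj⟩ := exists_nat_one_div_lt hε
      have hD : ∀ x y : X, dist x y ≤ Metric.diam (univ : Set X) := fun x y =>
        Metric.dist_le_diam_of_mem isCompact_univ.isBounded (mem_univ x) (mem_univ y)
      have hb : Tendsto (fun n : ℕ => 1 / ((j : ℝ) + 1) + Metric.diam (univ : Set X) * ∑ i,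
          |birkhoffSum T ((φ j ⁻¹' {i}).indicator (fun _ => (1 : ℝ))) n p.1 / n
          - birkhoffSum T ((φ j ⁻¹' {i}).indicator (fun _ => (1 : ℝ))) n p.2 / n|) atTop
          (nhds (1 / ((j : ℝ) + 1) + Metric.diam (univ : Set X) * ∑ i : ι j,
            |μ.real (φ j ⁻¹' {i}) - μ.real (φ j ⁻¹' {i})|)) :=
        tendsto_const_nhds.add (tendsto_const_nhds.mul
          (tendsto_finsetSum _ fun i _ => ((hp1 j i).sub (hp2 j i)).abs))
      simp only [sub_self, abs_zero, Finset.sum_const_zero, mul_zero, add_zero] at hb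
      filter_upwards [hb.eventually (gt_mem_nhds hj), eventually_gt_atTop 0] with n hn h0
      rw [Real.dist_eq, sub_zero, abs_of_nonneg (weakMeanN_nonneg T n _ _)]
      exact (weakMeanN_le T (φ j) Nat.one_div_pos_of_nat.le (hφ j) hD n h0 _ _).trans_lt hn
    exact hlim.limsup_eq
  have huniv : {p : X × X | weakMean T p.1 p.2 = 0} =ᵐ[μ.prod μ] univ :=
    eventuallyEq_univ.2 hmain
  rw [measure_congr huniv]
  exact measure_univ
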